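/- arXiv:2402.05347 — 3 statements merged into one kernel-verified Lean document; each statement's English description precedes it below -/
import Mathlib

section
/- Let F : ℝ^{m₁×m₂} × ℝ → ℝ^{m₁×m₂} satisfy ⟨F(Y,t), Y⟩ ≤ 0 for all Y ∈ ℝ^{m₁×m₂} and all t ∈ ℝ. Let Ũ ∈ ℝ^{m₁×s₁} and Ṽ ∈ ℝ^{m₂×s₂} have orthonormal columns, let Δt ≥ 0, let X̂ⁿ ∈ ℝ^{m₁×m₂}, and suppose Σ̃ ∈ ℝ^{s₁×s₂} satisfies the Galerkin fixed-point equation Σ̃ = Ũᵀ (X̂ⁿ + Δt · F(Ũ Σ̃ Ṽᵀ, t)) Ṽ. Then ‖Ũ Σ̃ Ṽᵀ‖_F ≤ ‖X̂ⁿ‖_F. Consequently, any matrix X̂ⁿ⁺¹ with ‖X̂ⁿ⁺¹‖_F ≤ ‖Ũ Σ̃ Ṽᵀ‖_F (e.g. obtained by SVD truncation of Ũ Σ̃ Ṽᵀ) satisfies ‖X̂ⁿ⁺¹‖_F ≤ ‖X̂ⁿ‖_F. -/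
open Matrix

/-- Frobenius inner product of two real matrices. -/
noncomputable def finner {m₁ m₂ : ℕ} (A B : Matrix (Fin m₁) (Fin m₂) ℝ) : ℝ :=
  ∑ i, ∑ j, A i j * B i j

/-- Frobenius norm of a real matrix. -/
noncomputable def fnorm {m₁ m₂ : ℕ} (A : Matrix (Fin m₁) (Fin m₂) ℝ) : ℝ :=
  Real.sqrt (finner A A)

theorem finner_eq_trace {m n : ℕ} (A B : Matrix (Fin m) (Fin n) ℝ) :
    finner A B = (A * Bᵀ).trace := by
  simp [finner, Matrix.trace, Matrix.mul_apply]

theorem finner_add_smul_left {m n : ℕ} (A B C : Matrix (Fin m) (Fin n) ℝ) (c : ℝ) :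
    finner (A + c • B) C = finner A C + c * finner B C := by
  simp [finner_eq_trace, Matrix.add_mul]

theorem finner_self_nonneg {m n : ℕ} (A : Matrix (Fin m) (Fin n) ℝ) : 0 ≤ finner A A :=
  Finset.sum_nonneg fun _ _ => Finset.sum_nonneg fun _ _ => mul_self_nonneg _

theorem finner_comm {m n : ℕ} (A B : Matrix (Fin m) (Fin n) ℝ) :
    finner A B = finner B A := by
  simp only [finner, mul_comm]

theorem finner_mul_mul_transpose {m n p q : ℕ} (Z : Matrix (Fin m) (Fin n) ℝ)
    (U : Matrix (Fin m) (Fin p) ℝ) (S : Matrix (Fin p) (Fin q) ℝ)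
    (V : Matrix (Fin n) (Fin q) ℝ) :
    finner Z (U * S * Vᵀ) = finner (Uᵀ * Z * V) S := by
  rw [finner_eq_trace, finner_eq_trace, Matrix.transpose_mul, Matrix.transpose_mul,
    Matrix.transpose_transpose, ← Matrix.mul_assoc, ← Matrix.mul_assoc, Matrix.trace_mul_comm]
  simp only [Matrix.mul_assoc]

theorem fnorm_le_of_finner_self_le {m n : ℕ} {X Y : Matrix (Fin m) (Fin n) ℝ}
    (h : finner Y Y ≤ finner X Y) : fnorm Y ≤ fnorm X := by
  refine Real.sqrt_le_sqrt ?_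
  have hsq := finner_self_nonneg (X + (-1 : ℝ) • Y)
  rw [finner_add_smul_left, finner_comm X, finner_comm Y, finner_add_smul_left,
    finner_add_smul_left, finner_comm Y X] at hsq
  linarith

theorem stmt_0 {m₁ m₂ s₁ s₂ : ℕ}
    (F : Matrix (Fin m₁) (Fin m₂) ℝ → ℝ → Matrix (Fin m₁) (Fin m₂) ℝ)
    (hF : ∀ Y t, finner (F Y t) Y ≤ 0)
    (U : Matrix (Fin m₁) (Fin s₁) ℝ) (V : Matrix (Fin m₂) (Fin s₂) ℝ)
    (hU : Uᵀ * U = 1) (hV : Vᵀ * V = 1)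
    (Δt : ℝ) (hΔt : 0 ≤ Δt)
    (Xn : Matrix (Fin m₁) (Fin m₂) ℝ) (t : ℝ)
    (S : Matrix (Fin s₁) (Fin s₂) ℝ)
    (hfix : S = Uᵀ * (Xn + Δt • F (U * S * Vᵀ) t) * V) :
    fnorm (U * S * Vᵀ) ≤ fnorm Xn ∧
      ∀ Xn1 : Matrix (Fin m₁) (Fin m₂) ℝ,
        fnorm Xn1 ≤ fnorm (U * S * Vᵀ) → fnorm Xn1 ≤ fnorm Xn := by
  have key : fnorm (U * S * Vᵀ) ≤ fnorm Xn := by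
    apply fnorm_le_of_finner_self_le
    have hgal : finner (Xn + Δt • F (U * S * Vᵀ) t) (U * S * Vᵀ) = finner S S := by
      rw [finner_mul_mul_transpose, ← hfix]
    have hiso : finner (U * S * Vᵀ) (U * S * Vᵀ) = finner S S := by
      have hproj : Uᵀ * (U * S * Vᵀ) * V = S := by
        rw [Matrix.mul_assoc U, ← Matrix.mul_assoc Uᵀ, hU, Matrix.one_mul, Matrix.mul_assoc,
          hV, Matrix.mul_one]
      rw [finner_mul_mul_transpose, hproj]
    rw [finner_add_smul_left] at hgal
    have hdiss := mul_nonpos_of_nonneg_of_nonpos hΔt (hF (U * S * Vᵀ) t)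
    linarith
  exact ⟨key, fun _ h => h.trans key⟩
end

section
/- For every L > 0 and B ≥ 0 there exists a constant C depending only on L and B with the following property. Let F : ℝ^{m₁×m₂} × ℝ → ℝ^{m₁×m₂} satisfy ‖F(Y,s) − F(Z,t)‖_F ≤ L‖Y−Z‖_F + L|s−t| and ‖F(Y,t)‖_F ≤ B for all Y, Z, s, t. Let 0 ≤ Δt ≤ 1/(2L), ε₁ ∈ [0, B], ε₂ ≥ 0, let X : ℝ → ℝ^{m₁×m₂} be differentiable with X′(t) = F(X(t),t) on [tⁿ, tⁿ+Δt] and X(tⁿ) = X̂ⁿ. Let Ũ, Ṽ have orthonormal columns and suppose there exists a matrix T with ‖F(X̂ⁿ,tⁿ) − T‖_F ≤ ε₁, Ũ Ũᵀ T Ṽ Ṽᵀ = T, and Ũ Ũᵀ X̂ⁿ Ṽ Ṽᵀ = X̂ⁿ. Let Σ̃ satisfy Σ̃ = Ũᵀ (X̂ⁿ + Δt · F(Ũ Σ̃ Ṽᵀ, tⁿ+Δt)) Ṽ, and let X̂ⁿ⁺¹ satisfy ‖X̂ⁿ⁺¹ − Ũ Σ̃ Ṽᵀ‖_F ≤ ε₂.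 Then ‖X(tⁿ + Δt) − X̂ⁿ⁺¹‖_F ≤ C Δt² + 2 Δt ε₁ + ε₂. -/
open Matrix

attribute [local instance] Matrix.frobeniusNormedAddCommGroup Matrix.frobeniusNormedSpace

theorem fnorm_eq_norm {m₁ m₂ : ℕ} (A : Matrix (Fin m₁) (Fin m₂) ℝ) : fnorm A = ‖A‖ := by
  rw [fnorm, finner, Matrix.frobenius_norm_def, ← Real.sqrt_eq_rpow]
  simp [sq]

theorem Matrix.frobenius_norm_sq_eq_trace {m₁ m₂ : ℕ} (A : Matrix (Fin m₁) (Fin m₂) ℝ) :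
    ‖A‖ ^ 2 = (Aᵀ * A).trace := by
  rw [← fnorm_eq_norm, fnorm, Real.sq_sqrt, finner, Finset.sum_comm]
  · simp [Matrix.trace, Matrix.mul_apply]
  · exact Finset.sum_nonneg fun i _ => Finset.sum_nonneg fun j _ => mul_self_nonneg _

theorem Matrix.frobenius_norm_mul_transpose_mul_le {m n s : ℕ} (U : Matrix (Fin m) (Fin s) ℝ)
    (hU : Uᵀ * U = 1) (A : Matrix (Fin m) (Fin n) ℝ) : ‖U * Uᵀ * A‖ ≤ ‖A‖ := by
  have hP : ((U * Uᵀ * A)ᵀ * (U * Uᵀ * A)) = Aᵀ * (U * Uᵀ * A) := by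
    simp only [Matrix.transpose_mul, Matrix.transpose_transpose, Matrix.mul_assoc]
    rw [← Matrix.mul_assoc Uᵀ U, hU, Matrix.one_mul]
  have hP' : (U * Uᵀ * A)ᵀ * A = Aᵀ * (U * Uᵀ * A) := by
    simp only [Matrix.transpose_mul, Matrix.transpose_transpose, Matrix.mul_assoc]
  have h : ‖A - U * Uᵀ * A‖ ^ 2 = ‖A‖ ^ 2 - ‖U * Uᵀ * A‖ ^ 2 := by
    simp only [Matrix.frobenius_norm_sq_eq_trace, Matrix.transpose_sub, Matrix.sub_mul,
      Matrix.mul_sub A.transpose, Matrix.mul_sub (U * Uᵀ * A).transpose, hP, hP',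
      Matrix.trace_sub]
    ring
  exact abs_le_of_sq_le_sq' (by nlinarith [sq_nonneg ‖A - U * Uᵀ * A‖]) (norm_nonneg _) |>.2

theorem Matrix.frobenius_norm_mul_mul_transpose_le {m n s : ℕ} (V : Matrix (Fin n) (Fin s) ℝ)
    (hV : Vᵀ * V = 1) (A : Matrix (Fin m) (Fin n) ℝ) : ‖A * V * Vᵀ‖ ≤ ‖A‖ := by
  have h := Matrix.frobenius_norm_mul_transpose_mul_le V hV Aᵀ
  rw [← Matrix.frobenius_norm_transpose] at h
  simpa [Matrix.mul_assoc, Matrix.frobenius_norm_transpose] using h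

/-- Two-sided compression by matrices with orthonormal columns is a Frobenius contraction. -/
theorem Matrix.frobenius_norm_compression_le {m n s₁ s₂ : ℕ}
    (U : Matrix (Fin m) (Fin s₁) ℝ) (V : Matrix (Fin n) (Fin s₂) ℝ)
    (hU : Uᵀ * U = 1) (hV : Vᵀ * V = 1) (A : Matrix (Fin m) (Fin n) ℝ) :
    ‖U * Uᵀ * A * V * Vᵀ‖ ≤ ‖A‖ :=
  (Matrix.frobenius_norm_mul_mul_transpose_le V hV _).trans
    (Matrix.frobenius_norm_mul_transpose_mul_le U hU A)

theorem Matrix.hasDerivAt_of_entries {m n : ℕ} {X : ℝ → Matrix (Fin m) (Fin n) ℝ}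
    {X' : Matrix (Fin m) (Fin n) ℝ} {t : ℝ}
    (h : ∀ i j, HasDerivAt (fun τ => X τ i j) (X' i j) t) : HasDerivAt X X' t := by
  exact hasDerivAt_pi.2 fun i => hasDerivAt_pi.2 fun j => h i j

/-- The explicit Euler step has a quadratic local error along a Lipschitz bounded field. -/
theorem norm_sub_euler_step_le {E : Type*} [NormedAddCommGroup E] [NormedSpace ℝ E]
    {L B : ℝ} (hL : 0 ≤ L) (hB : 0 ≤ B) {F : E → ℝ → E}
    (hLip : ∀ Y Z s t, ‖F Y s - F Z t‖ ≤ L * ‖Y - Z‖ + L * |s - t|)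
    (hBd : ∀ Y t, ‖F Y t‖ ≤ B) {a h : ℝ} (hh : 0 ≤ h) {X : ℝ → E}
    (hX : ∀ t ∈ Set.Icc a (a + h), HasDerivAt X (F (X t) t) t) :
    ‖X (a + h) - X a - h • F (X a) a‖ ≤ L * (B + 1) * h ^ 2 := by
  have hgrow : ∀ t ∈ Set.Icc a (a + h), ‖X t - X a‖ ≤ B * (t - a) :=
    norm_image_sub_le_of_norm_deriv_le_segment' (fun t ht => (hX t ht).hasDerivWithinAt)
      fun t _ => hBd _ _
  have key := norm_image_sub_le_of_norm_deriv_le_segment'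
    (f := fun t => X t - t • F (X a) a) (f' := fun t => F (X t) t - F (X a) a)
    (a := a) (b := a + h) (C := L * (B + 1) * h)
    (fun t ht => by
      simpa using! ((hX t ht).sub ((hasDerivAt_id t).smul_const (F (X a) a))).hasDerivWithinAt)
    (fun t ht => by
      have h1 := hgrow t ⟨ht.1, ht.2.le⟩
      have h2 : |t - a| ≤ h := by rw [abs_of_nonneg (by linarith [ht.1])]; linarith [ht.2]
      have h3 : ‖X t - X a‖ ≤ B * h := h1.trans (by gcongr; linarith [ht.2])
      calc ‖F (X t) t - F (X a) a‖ ≤ L * ‖X t - X a‖ + L * |t - a| := hLip _ _ _ _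
        _ ≤ L * (B * h) + L * h := by gcongr
        _ = L * (B + 1) * h := by ring)
    (a + h) ⟨by linarith, le_rfl⟩
  have e : X (a + h) - X a - h • F (X a) a
      = (X (a + h) - (a + h) • F (X a) a) - (X a - a • F (X a) a) := by module
  rw [e]
  exact key.trans (by apply le_of_eq; ring)

theorem stmt_11 (L B : ℝ) (hL : 0 < L) (hB : 0 ≤ B) :
    ∃ C : ℝ, ∀ (m₁ m₂ s₁ s₂ : ℕ)
      (F : Matrix (Fin m₁) (Fin m₂) ℝ → ℝ → Matrix (Fin m₁) (Fin m₂) ℝ),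
      (∀ Y Z s t, fnorm (F Y s - F Z t) ≤ L * fnorm (Y - Z) + L * |s - t|) →
      (∀ Y t, fnorm (F Y t) ≤ B) →
      ∀ (tn Δt ε₁ ε₂ : ℝ), 0 ≤ Δt → Δt ≤ 1 / (2 * L) →
        0 ≤ ε₁ → ε₁ ≤ B → 0 ≤ ε₂ →
      ∀ (X : ℝ → Matrix (Fin m₁) (Fin m₂) ℝ),
        (∀ t ∈ Set.Icc tn (tn + Δt), ∀ i j,
          HasDerivAt (fun τ => X τ i j) (F (X t) t i j) t) →
      ∀ (Xn : Matrix (Fin m₁) (Fin m₂) ℝ), X tn = Xn →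
      ∀ (U : Matrix (Fin m₁) (Fin s₁) ℝ) (V : Matrix (Fin m₂) (Fin s₂) ℝ),
        Uᵀ * U = 1 → Vᵀ * V = 1 →
        (∃ T : Matrix (Fin m₁) (Fin m₂) ℝ,
          fnorm (F Xn tn - T) ≤ ε₁ ∧ U * Uᵀ * T * V * Vᵀ = T) →
        U * Uᵀ * Xn * V * Vᵀ = Xn →
      ∀ S : Matrix (Fin s₁) (Fin s₂) ℝ,
        S = Uᵀ * (Xn + Δt • F (U * S * Vᵀ) (tn + Δt)) * V →
      ∀ Xn1 : Matrix (Fin m₁) (Fin m₂) ℝ,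
        fnorm (Xn1 - U * S * Vᵀ) ≤ ε₂ →
        fnorm (X (tn + Δt) - Xn1) ≤ C * Δt ^ 2 + 2 * Δt * ε₁ + ε₂ := by
  refine ⟨2 * (L * (B + 1)), ?_⟩
  intro m₁ m₂ s₁ s₂ F hLip hBd tn Δt ε₁ ε₂ hΔ _ _ _ _ X hX Xn hXn U V hU hV ⟨T, hT, hPT⟩ hPX
    S hS Xn1 hXn1
  simp only [fnorm_eq_norm] at *
  subst hXn
  set W := U * S * Vᵀ with hW
  set F₀ := F (X tn) tn
  set F₁ := F W (tn + Δt)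
  have hWeq : W = X tn + Δt • (U * Uᵀ * F₁ * V * Vᵀ) := by
    calc W = U * Uᵀ * (X tn + Δt • F₁) * V * Vᵀ := by
          rw [hW, hS]; simp only [Matrix.mul_assoc]
      _ = X tn + Δt • (U * Uᵀ * F₁ * V * Vᵀ) := by
          simp only [Matrix.mul_add, Matrix.add_mul, Matrix.mul_smul, Matrix.smul_mul, hPX]
  have hproj := Matrix.frobenius_norm_compression_le U V hU hV
  have hstep : ‖X tn - W‖ ≤ Δt * B := by
    have e : X tn - W = -(Δt • (U * Uᵀ * F₁ * V * Vᵀ)) := by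
      nth_rewrite 1 [hWeq]
      abel
    rw [e, norm_neg, norm_smul, Real.norm_of_nonneg hΔ]
    exact mul_le_mul_of_nonneg_left ((hproj _).trans (hBd _ _)) hΔ
  have heuler : ‖X (tn + Δt) - X tn - Δt • F₀‖ ≤ L * (B + 1) * Δt ^ 2 :=
    norm_sub_euler_step_le hL.le hB hLip hBd hΔ
      fun t ht => Matrix.hasDerivAt_of_entries (hX t ht)
  have hfield : ‖F₀ - F₁‖ ≤ L * (B + 1) * Δt := by
    calc ‖F₀ - F₁‖ ≤ L * ‖X tn - W‖ + L * |tn - (tn + Δt)| := hLip _ _ _ _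
      _ = L * ‖X tn - W‖ + L * Δt := by
          rw [sub_add_cancel_left, abs_neg, abs_of_nonneg hΔ]
      _ ≤ L * (Δt * B) + L * Δt := by gcongr
      _ = L * (B + 1) * Δt := by ring
  have hsplit : X (tn + Δt) - Xn1 = (X (tn + Δt) - X tn - Δt • F₀)
      + Δt • ((F₀ - T) - U * Uᵀ * (F₀ - T) * V * Vᵀ)
      + Δt • (U * Uᵀ * (F₀ - F₁) * V * Vᵀ) - (Xn1 - W) := by
    nth_rewrite 1 [hWeq]
    simp only [Matrix.mul_sub, Matrix.sub_mul, hPT]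
    module
  have hres : ‖(F₀ - T) - U * Uᵀ * (F₀ - T) * V * Vᵀ‖ ≤ 2 * ε₁ := by
    linarith [norm_sub_le (F₀ - T) (U * Uᵀ * (F₀ - T) * V * Vᵀ), hproj (F₀ - T)]
  rw [hsplit]
  calc _ ≤ ‖X (tn + Δt) - X tn - Δt • F₀‖
        + ‖Δt • ((F₀ - T) - U * Uᵀ * (F₀ - T) * V * Vᵀ)‖
        + ‖Δt • (U * Uᵀ * (F₀ - F₁) * V * Vᵀ)‖ + ‖Xn1 - W‖ :=
        (norm_sub_le _ _).trans (by gcongr; exact norm_add₃_le)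
    _ ≤ L * (B + 1) * Δt ^ 2 + Δt * (2 * ε₁) + Δt * (L * (B + 1) * Δt) + ε₂ := by
        rw [norm_smul, norm_smul, Real.norm_of_nonneg hΔ]
        gcongr
        exact (hproj _).trans hfield
    _ = _ := by ring
end

section
/- Let F : ℝ^{m₁×m₂} × ℝ → ℝ^{m₁×m₂} be any map, let Ũ ∈ ℝ^{m₁×s₁}, Ṽ ∈ ℝ^{m₂×s₂} have orthonormal columns, and let X̂ⁿ ∈ ℝ^{m₁×m₂} and tⁿ, Δt ∈ ℝ satisfy Ũ Ũᵀ X̂ⁿ Ṽ Ṽᵀ = X̂ⁿ and Ũ Ũᵀ F(X̂ⁿ, tⁿ) Ṽ Ṽᵀ = F(X̂ⁿ, tⁿ). If Σ̃ ∈ ℝ^{s₁×s₂} satisfies Σ̃ = Ũᵀ (X̂ⁿ + Δt · F(Ũ Σ̃ Ṽᵀ, tⁿ+Δt)) Ṽ, then the matrix X̂ⁿ⁺¹ᐧᵖʳᵉ = Ũ Σ̃ Ṽᵀ satisfies the identity X̂ⁿ⁺¹ᐧᵖʳᵉ = X̂ⁿ + Δt · F(X̂ⁿ, tⁿ) + Δt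 · Ũ Ũᵀ (F(X̂ⁿ⁺¹ᐧᵖʳᵉ, tⁿ+Δt) − F(X̂ⁿ, tⁿ)) Ṽ Ṽᵀ. -/
open Matrix

theorem stmt_12 {m₁ m₂ s₁ s₂ : ℕ}
    (F : Matrix (Fin m₁) (Fin m₂) ℝ → ℝ → Matrix (Fin m₁) (Fin m₂) ℝ)
    (U : Matrix (Fin m₁) (Fin s₁) ℝ) (V : Matrix (Fin m₂) (Fin s₂) ℝ)
    (hU : Uᵀ * U = 1) (hV : Vᵀ * V = 1)
    (Xn : Matrix (Fin m₁) (Fin m₂) ℝ) (tn Δt : ℝ)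
    (hXproj : U * Uᵀ * Xn * V * Vᵀ = Xn)
    (hFproj : U * Uᵀ * F Xn tn * V * Vᵀ = F Xn tn)
    (S : Matrix (Fin s₁) (Fin s₂) ℝ)
    (hfix : S = Uᵀ * (Xn + Δt • F (U * S * Vᵀ) (tn + Δt)) * V) :
    U * S * Vᵀ =
      Xn + Δt • F Xn tn +
        Δt • (U * Uᵀ * (F (U * S * Vᵀ) (tn + Δt) - F Xn tn) * V * Vᵀ) := by
  generalize F (U * S * Vᵀ) (tn + Δt) = G at hfix ⊢
  have hS : U * S * Vᵀ = U * Uᵀ * Xn * V * Vᵀ + Δt • (U * Uᵀ * G * V * Vᵀ) := by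
    rw [hfix]
    simp only [Matrix.mul_add, Matrix.add_mul, Matrix.mul_smul, Matrix.smul_mul,
      Matrix.mul_assoc]
  rw [hS, hXproj, Matrix.mul_sub, Matrix.sub_mul, Matrix.sub_mul, hFproj, smul_sub]
  abel
end
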